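/- Let F, G1, G2 be jointly distributed finite-valued random variables. The following are equivalent: (a) there exist random variables U, Z1, Z2 adjoinable to (F,G1,G2) such that U is uniform over a 4-element set, F is uniform over a 2-element set, H(F,G1,G2 | U) = 0, I(G1;G2|F) = 0, Z1 is uniform over a 3-element set with I(Z1;G1)=0 and H(U|G1,Z1)=0, and Z2 is uniform over a 3-element set with I(Z2;G2)=0 and H(U|G2,Z2)=0; (b) there exist injections from the supports of F, G1, G2 into {0,1} under which the relabeled triple (F,G1,G2) is uniformly distributed over the set {(0,0,0),(0,1,0),(1,0,0),(1,0,1)}. -/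

import Mathlib

namespace CIPaper

/-- A bundled probability space. -/
structure ProbSpace where
  carrier : Type
  [inst : MeasurableSpace carrier]
  μ : MeasureTheory.Measure carrier
  [isProb : MeasureTheory.IsProbabilityMeasure μ]

attribute [instance] ProbSpace.inst ProbSpace.isProb

/-- A bundled finite measurable alphabet, used as value space of auxiliary random variables. -/
structure FinAlphabet where
  carrier : Type
  [fin : Fintype carrier]
  [ms : MeasurableSpace carrier]
  [msc : MeasurableSingletonClass carrier]

attribute [instance] FinAlphabet.fin FinAlphabet.ms FinAlphabet.msc

open MeasureTheory ProbabilityTheory Real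

variable {Ω : Type*} [MeasurableSpace Ω] {S T U : Type*}

/-- P(X = x). -/
noncomputable def pr (μ : Measure Ω) (X : Ω → S) (x : S) : ℝ :=
  (μ (X ⁻¹' {x})).toReal

/-- Shannon entropy (base 2) of a finite-valued random variable. -/
noncomputable def ent (μ : Measure Ω) [Fintype S] (X : Ω → S) : ℝ :=
  (∑ x, Real.negMulLog (pr μ X x)) / Real.log 2

/-- Conditional entropy H(X|Y). -/
noncomputable def condEnt (μ : Measure Ω) [Fintype S] [Fintype T]
    (X : Ω → S) (Y : Ω → T) : ℝ :=
  ent μ (fun ω => (X ω, Y ω)) - ent μ Y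

/-- Mutual information I(X;Y). -/
noncomputable def mi (μ : Measure Ω) [Fintype S] [Fintype T]
    (X : Ω → S) (Y : Ω → T) : ℝ :=
  ent μ X + ent μ Y - ent μ (fun ω => (X ω, Y ω))

/-- Conditional mutual information I(X;Y|Z). -/
noncomputable def cmi (μ : Measure Ω) [Fintype S] [Fintype T] [Fintype U]
    (X : Ω → S) (Y : Ω → T) (Z : Ω → U) : ℝ :=
  ent μ (fun ω => (X ω, Z ω)) + ent μ (fun ω => (Y ω, Z ω))
    - ent μ (fun ω => (X ω, (Y ω, Z ω))) - ent μ Z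

/-- The support of a random variable: values of positive probability. -/
def support (μ : Measure Ω) (X : Ω → S) : Set S := {x | 0 < pr μ X x}

/-- X is uniformly distributed over its support. -/
def IsUniform (μ : Measure Ω) (X : Ω → S) : Prop :=
  ∀ x ∈ support μ X, ∀ y ∈ support μ X, pr μ X x = pr μ X y

/-- X is uniformly distributed over a support of size n. -/
def UniformOn (μ : Measure Ω) (X : Ω → S) (n : ℕ) : Prop :=
  IsUniform μ X ∧ (support μ X).ncard = n

/-- The TRIPLE predicate: pairwise independence plus each variable a function of the
other two. -/
def TRIPLE (μ : Measure Ω) [Fintype S] [Fintype T] [Fintype U]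
    (X : Ω → S) (Y : Ω → T) (Z : Ω → U) : Prop :=
  condEnt μ X (fun ω => (Y ω, Z ω)) = 0 ∧ condEnt μ Y (fun ω => (X ω, Z ω)) = 0 ∧
    condEnt μ Z (fun ω => (X ω, Y ω)) = 0 ∧
    mi μ X Y = 0 ∧ mi μ X Z = 0 ∧ mi μ Y Z = 0

end CIPaper

namespace CIPaper

open MeasureTheory ProbabilityTheory Real

/-- The triple (F,G₁,G₂) is, after injective relabeling of the supports into {0,1},
uniformly distributed over {(0,0,0),(0,1,0),(1,0,0),(1,0,1)}. -/
def FlipDist {Ω : Type*} [MeasurableSpace Ω] (μ : Measure Ω) {S T U : Type*}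
    (F : Ω → S) (G₁ : Ω → T) (G₂ : Ω → U) : Prop :=
  ∃ (f : S → Fin 2) (g₁ : T → Fin 2) (g₂ : U → Fin 2),
    Set.InjOn f (support μ F) ∧ Set.InjOn g₁ (support μ G₁) ∧ Set.InjOn g₂ (support μ G₂) ∧
    ∀ a b c : Fin 2,
      pr μ (fun ω => (f (F ω), g₁ (G₁ ω), g₂ (G₂ ω))) (a, b, c) =
        if (a, b, c) ∈ ({((0:Fin 2), (0:Fin 2), (0:Fin 2)), (0, 1, 0), (1, 0, 0), (1, 0, 1)} :
            Finset (Fin 2 × Fin 2 × Fin 2)) then (4:ℝ)⁻¹ else 0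

end CIPaper

namespace CIPaper

open MeasureTheory ProbabilityTheory Real

section Combinatorics

open Classical in
/-- A function on four points whose fibres have one or three elements. -/
lemma four_points {S T : Type*} {a b c d : S} (hab : a ≠ b) (hac : a ≠ c) (had : a ≠ d)
    (hbc : b ≠ c) (hbd : b ≠ d) (hcd : c ≠ d) (g : S → T)
    (h : ∀ u ∈ ({a, b, c, d} : Finset S),
      ((({a, b, c, d} : Finset S)).filter fun v => g v = g u).card ∣ 3) :
    (g a ≠ g b ∧ g a ≠ g c ∧ g a ≠ g d ∧ g b ≠ g c ∧ g b ≠ g d ∧ g c ≠ g d) ∨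
    (g a ≠ g b ∧ g c = g b ∧ g d = g b) ∨ (g b ≠ g a ∧ g c = g a ∧ g d = g a) ∨
    (g b = g a ∧ g c ≠ g a ∧ g d = g a) ∨ (g b = g a ∧ g c = g a ∧ g d ≠ g a) := by
  have h3 : ∀ n, n ∣ 3 → n = 1 ∨ n = 3 := fun n hn => (Nat.dvd_prime Nat.prime_three).1 hn
  have e : ∀ t : T, ((({a, b, c, d} : Finset S)).filter fun v => g v = t).card =
      (if g a = t then 1 else 0) + ((if g b = t then 1 else 0) + ((if g c = t then 1 else 0) +
        (if g d = t then 1 else 0))) := by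
    intro t
    rw [Finset.card_filter, Finset.sum_insert (by simp [*]), Finset.sum_insert (by simp [*]),
      Finset.sum_insert (by simp [*]), Finset.sum_singleton]
  have ha := h3 _ (h a (by simp))
  have hb := h3 _ (h b (by simp))
  have hc := h3 _ (h c (by simp))
  have hd := h3 _ (h d (by simp))
  rw [e] at ha hb hc hd
  clear e h h3
  grind

open Classical in
lemma exists_flip_pattern {S T U R : Type*} {A : Finset S} (hA : A.card = 4) (f : S → R)
    (g₁ : S → T) (g₂ : S → U) (hf : ∀ u ∈ A, (A.filter fun v => f v = f u).card = 2)
    (h₁ : ∀ u ∈ A, (A.filter fun v => g₁ v = g₁ u).card ∣ 3)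
    (h₂ : ∀ u ∈ A, (A.filter fun v => g₂ v = g₂ u).card ∣ 3)
    (h : ∀ u ∈ A, ∀ v ∈ A, f u = f v → g₁ u = g₁ v ∨ g₂ u = g₂ v) :
    ∃ a b c d, A = {a, b, c, d} ∧ a ∉ ({b, c, d} : Finset S) ∧ b ∉ ({c, d} : Finset S) ∧
      c ∉ ({d} : Finset S) ∧ f b = f a ∧ f d = f c ∧ f c ≠ f a ∧
      g₁ b ≠ g₁ a ∧ g₁ c = g₁ a ∧ g₁ d = g₁ a ∧ g₂ b = g₂ a ∧ g₂ c = g₂ a ∧ g₂ d ≠ g₂ a := by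
  obtain ⟨o, ho⟩ : A.Nonempty := Finset.card_pos.1 (by omega)
  have hsplit := Finset.card_filter_add_card_filter_not (s := A) (fun v => f v = f o)
  obtain ⟨a, b, hab, e₁⟩ := Finset.card_eq_two.1 (hf o ho)
  obtain ⟨c, d, hcd, e₂⟩ := Finset.card_eq_two.1
    (show (A.filter fun v => ¬ f v = f o).card = 2 by have := hf o ho; omega)
  have ma : a ∈ A ∧ f a = f o := by
    rw [← Finset.mem_filter (p := fun v => f v = f o), e₁]; simp
  have mb : b ∈ A ∧ f b = f o := by
    rw [← Finset.mem_filter (p := fun v => f v = f o), e₁]; simp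
  have mc : c ∈ A ∧ ¬ f c = f o := by
    rw [← Finset.mem_filter (p := fun v => ¬ f v = f o), e₂]; simp
  have md : d ∈ A ∧ ¬ f d = f o := by
    rw [← Finset.mem_filter (p := fun v => ¬ f v = f o), e₂]; simp
  have hAe : A = {a, b, c, d} := by
    rw [← Finset.filter_union_filter_not_eq (fun v => f v = f o) A, e₁, e₂]
    ext x; simp only [Finset.mem_union, Finset.mem_insert, Finset.mem_singleton]; tauto
  have hac : a ≠ c := fun e => mc.2 (e ▸ ma.2)
  have had : a ≠ d := fun e => md.2 (e ▸ ma.2)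
  have hbc : b ≠ c := fun e => mc.2 (e ▸ mb.2)
  have hbd : b ≠ d := fun e => md.2 (e ▸ mb.2)
  have hfcd : f d = f c := by
    by_contra hne
    have h2 := hf c mc.1
    rw [Finset.card_eq_two] at h2
    obtain ⟨p, q, hpq, e⟩ := h2
    have hp : p ∈ A ∧ f p = f c := by
      rw [← Finset.mem_filter (p := fun v => f v = f c), e]; simp
    have hq : q ∈ A ∧ f q = f c := by
      rw [← Finset.mem_filter (p := fun v => f v = f c), e]; simp
    have hp' := hp.1
    have hq' := hq.1
    rw [hAe] at hp' hq'
    simp only [Finset.mem_insert, Finset.mem_singleton] at hp' hq'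
    grind
  have hg := h a ma.1 b mb.1 (ma.2.trans mb.2.symm)
  have hg' := h c mc.1 d md.1 hfcd.symm
  have hfba : f b = f a := mb.2.trans ma.2.symm
  have hfca : f c ≠ f a := fun e => mc.2 (e.trans ma.2)
  clear h hf hsplit e₁ e₂ ma mb mc md
  subst hAe
  have p₁ := four_points hab hac had hbc hbd hcd g₁ h₁
  have p₂ := four_points hab hac had hbc hbd hcd g₂ h₂
  clear h₁ h₂ hA
  have w₁ : ({a, b, c, d} : Finset S) = {b, a, c, d} := by grind
  have w₂ : ({a, b, c, d} : Finset S) = {a, b, d, c} := by grind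
  have w₃ : ({a, b, c, d} : Finset S) = {b, a, d, c} := by grind
  have w₄ : ({a, b, c, d} : Finset S) = {c, d, a, b} := by grind
  have w₅ : ({a, b, c, d} : Finset S) = {d, c, a, b} := by grind
  have w₆ : ({a, b, c, d} : Finset S) = {c, d, b, a} := by grind
  have w₇ : ({a, b, c, d} : Finset S) = {d, c, b, a} := by grind
  simp only [Finset.mem_insert, Finset.mem_singleton]
  rcases p₁ with p₁ | p₁ | p₁ | p₁ | p₁ <;> rcases p₂ with p₂ | p₂ | p₂ | p₂ | p₂
  all_goals first
    | (exfalso; grind)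
    | (refine ⟨a, b, c, d, rfl, ?_⟩; grind)
    | (refine ⟨b, a, c, d, w₁, ?_⟩; grind)
    | (refine ⟨a, b, d, c, w₂, ?_⟩; grind)
    | (refine ⟨b, a, d, c, w₃, ?_⟩; grind)
    | (refine ⟨c, d, a, b, w₄, ?_⟩; grind)
    | (refine ⟨d, c, a, b, w₅, ?_⟩; grind)
    | (refine ⟨c, d, b, a, w₆, ?_⟩; grind)
    | (refine ⟨d, c, b, a, w₇, ?_⟩; grind)

open Classical in
lemma filter_pair_eq {S R : Type*} {A : Finset S} {f : S → R} {u v : S}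
    (hA : (A.filter fun w => f w = f u).card = 2) (hu : u ∈ A) (hv : v ∈ A) (huv : u ≠ v)
    (hf : f u = f v) : A.filter (fun w => f w = f u) = {u, v} := by
  symm
  apply Finset.eq_of_subset_of_card_le
  · intro w hw
    simp only [Finset.mem_insert, Finset.mem_singleton] at hw
    rcases hw with rfl | rfl <;> simp [*]
  · rw [hA, Finset.card_pair huv]

end Combinatorics

section Entropy

variable {Ω : Type*} [MeasurableSpace Ω] {μ : Measure Ω}
  {S T U : Type*}

lemma pr_nonneg (X : Ω → S) (x : S) : 0 ≤ pr μ X x := ENNReal.toReal_nonneg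

lemma pr_congr_ae {X Y : Ω → S} (h : X =ᵐ[μ] Y) (x : S) : pr μ X x = pr μ Y x := by
  unfold pr
  congr 1
  apply measure_congr
  filter_upwards [h] with ω hω
  change (X ω = x) = (Y ω = x)
  rw [hω]

lemma mem_support_of_ne {X : Ω → S} {x : S} (h : pr μ X x ≠ 0) : x ∈ support μ X :=
  lt_of_le_of_ne (pr_nonneg X x) h.symm

variable [IsProbabilityMeasure μ] [Fintype S] [Fintype T] [Fintype U]
  [MeasurableSpace S] [MeasurableSingletonClass S]
  [MeasurableSpace T] [MeasurableSingletonClass T]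
  [MeasurableSpace U] [MeasurableSingletonClass U]

/-- The law of a function of a finite-valued random variable. -/
lemma pr_comp {R : Type*} [DecidableEq R] {X : Ω → S} (hX : Measurable X) (f : S → R) (y : R) :
    pr μ (fun ω => f (X ω)) y = ∑ x, if f x = y then pr μ X x else 0 := by
  rw [← Finset.sum_filter]
  have : (fun ω => f (X ω)) ⁻¹' {y} = ⋃ x ∈ Finset.univ.filter (fun x => f x = y), X ⁻¹' {x} := by
    ext ω; simp
  unfold pr
  rw [this]
  refine measureReal_biUnion_finset (μ := μ) ?_ ?_
  · intro a _ b _ hab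
    refine Set.disjoint_left.2 fun ω h1 h2 => hab ?_
    simp only [Set.mem_preimage, Set.mem_singleton_iff] at h1 h2
    rw [← h1, h2]
  · intro x _
    exact hX (measurableSet_singleton x)

omit [Fintype S] [MeasurableSpace S] [MeasurableSingletonClass S] in
lemma pr_le_comp {R : Type*} {X : Ω → S} (f : S → R) (x : S) :
    pr μ X x ≤ pr μ (fun ω => f (X ω)) (f x) := by
  refine measureReal_mono (μ := μ) fun ω h => ?_
  simp only [Set.mem_preimage, Set.mem_singleton_iff] at h ⊢
  rw [h]

lemma sum_pr {X : Ω → S} (hX : Measurable X) : ∑ x, pr μ X x = 1 := by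
  have h := pr_comp (μ := μ) hX (fun _ => ()) ()
  simp only [if_true] at h
  rw [← h]
  simp [pr]

lemma sum_pr_fst {X : Ω → S} {Y : Ω → T} (hX : Measurable X) (hY : Measurable Y) (y : T) :
    ∑ x, pr μ (fun ω => (X ω, Y ω)) (x, y) = pr μ Y y := by
  classical
  rw [pr_comp (hX.prodMk hY) Prod.snd y, Fintype.sum_prod_type]
  simp

omit [MeasurableSpace T] [MeasurableSingletonClass T] in
/-- The entropy of a function of `W` as an expectation over the law of `W`. -/
lemma ent_comp {W : Ω → S} (hW : Measurable W) (f : S → T) :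
    ent μ (fun ω => f (W ω)) =
      (∑ w, pr μ W w * -log (pr μ (fun ω => f (W ω)) (f w))) / log 2 := by
  classical
  unfold ent
  congr 1
  have : ∀ y, negMulLog (pr μ (fun ω => f (W ω)) y) =
      ∑ w, if f w = y then pr μ W w * -log (pr μ (fun ω => f (W ω)) y) else 0 := by
    intro y
    rw [negMulLog, neg_mul, ← mul_neg]
    conv_lhs => rw [pr_comp hW f y]
    rw [Finset.sum_mul]
    refine Finset.sum_congr rfl fun w _ => ?_
    split_ifs with h
    · rw [pr_comp hW f y]
    · simp
  simp_rw [this]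
  rw [Finset.sum_comm]
  simp

lemma sub_le_mul_log_sub {a b : ℝ} (ha : 0 ≤ a) (hb : 0 ≤ b) (h : b = 0 → a = 0) :
    a - b ≤ a * (log a - log b) ∧ (a * (log a - log b) = a - b → a = b) := by
  rcases ha.eq_or_lt with rfl | ha
  · simp only [zero_mul, zero_sub]
    exact ⟨by linarith, fun h => by linarith⟩
  have hb' : 0 < b := lt_of_le_of_ne hb fun e => ha.ne' (h e.symm)
  have e : log a - log b = -log (b / a) := by rw [log_div hb'.ne' ha.ne']; ring
  have e2 : a * (b / a) = b := by field_simp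
  rw [e]
  constructor
  · nlinarith [log_le_sub_one_of_pos (div_pos hb' ha)]
  · intro heq
    by_contra hne
    have hba : b / a ≠ 1 := fun h1 => hne (by rw [h1] at e2; linarith)
    nlinarith [log_lt_sub_one_of_pos (div_pos hb' ha) hba]

/-- Relative entropy of two finite mass functions vanishes exactly when they agree. -/
lemma sum_mul_log_sub_eq_zero_iff {ι : Type*} [Fintype ι] {a b : ι → ℝ} (ha : ∀ i, 0 ≤ a i)
    (hb : ∀ i, 0 ≤ b i) (h : ∀ i, b i = 0 → a i = 0) (hs : ∑ i, a i = ∑ i, b i) :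
    ∑ i, a i * (log (a i) - log (b i)) = 0 ↔ ∀ i, a i = b i := by
  constructor
  · intro h0 i
    have h1 : ∑ i, (a i - b i) = ∑ i, a i * (log (a i) - log (b i)) := by
      rw [h0, Finset.sum_sub_distrib, hs, sub_self]
    have h2 := (Finset.sum_eq_sum_iff_of_le fun i _ =>
      (sub_le_mul_log_sub (ha i) (hb i) (h i)).1).1 h1
    exact (sub_le_mul_log_sub (ha i) (hb i) (h i)).2 (h2 i (Finset.mem_univ i)).symm
  · intro h
    simp [h]

lemma mi_eq_zero_iff {X : Ω → S} {Y : Ω → T} (hX : Measurable X) (hY : Measurable Y) :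
    mi μ X Y = 0 ↔ ∀ x y, pr μ (fun ω => (X ω, Y ω)) (x, y) = pr μ X x * pr μ Y y := by
  have hW := hX.prodMk hY
  have h1 := ent_comp (μ := μ) hW Prod.fst
  have h2 := ent_comp (μ := μ) hW Prod.snd
  have h3 := ent_comp (μ := μ) hW id
  simp only [id] at h1 h2 h3
  have key : ∀ w : S × T, (pr μ X w.1 * pr μ Y w.2 = 0 → pr μ (fun ω => (X ω, Y ω)) w = 0) := by
    intro w hw
    have a := pr_le_comp (μ := μ) (X := fun ω => (X ω, Y ω)) Prod.fst w
    have b := pr_le_comp (μ := μ) (X := fun ω => (X ω, Y ω)) Prod.snd w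
    have c := pr_nonneg (μ := μ) (fun ω => (X ω, Y ω)) w
    rcases mul_eq_zero.1 hw with h | h
    · exact le_antisymm (a.trans h.le) c
    · exact le_antisymm (b.trans h.le) c
  have h4 := sum_mul_log_sub_eq_zero_iff (a := pr μ (fun ω => (X ω, Y ω)))
    (b := fun w => pr μ X w.1 * pr μ Y w.2) (pr_nonneg _)
    (fun w => mul_nonneg (pr_nonneg _ _) (pr_nonneg _ _)) key
    (by rw [sum_pr hW, Fintype.sum_prod_type]
        simp_rw [← Finset.mul_sum]
        simp [sum_pr hX, sum_pr hY])
  rw [Prod.forall] at h4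
  rw [← h4]
  unfold mi
  rw [h1, h2, h3, ← add_div, ← sub_div, div_eq_zero_iff, or_iff_left (log_pos one_lt_two).ne',
    ← Finset.sum_add_distrib, ← Finset.sum_sub_distrib]
  refine Eq.congr (Finset.sum_congr rfl fun w _ => ?_) rfl
  by_cases hw : pr μ (fun ω => (X ω, Y ω)) w = 0
  · simp [hw]
  · have := mt (key w) hw
    rw [mul_eq_zero, not_or] at this
    rw [log_mul this.1 this.2]
    ring

lemma cmi_eq_zero_iff {X : Ω → S} {Y : Ω → T} {Z : Ω → U} (hX : Measurable X)
    (hY : Measurable Y) (hZ : Measurable Z) :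
    cmi μ X Y Z = 0 ↔ ∀ x y z, pr μ (fun ω => (X ω, (Y ω, Z ω))) (x, (y, z)) * pr μ Z z =
      pr μ (fun ω => (X ω, Z ω)) (x, z) * pr μ (fun ω => (Y ω, Z ω)) (y, z) := by
  have hW := hX.prodMk (hY.prodMk hZ)
  have h1 := ent_comp (μ := μ) hW (fun w => (w.1, w.2.2))
  have h2 := ent_comp (μ := μ) hW (fun w => (w.2.1, w.2.2))
  have h3 := ent_comp (μ := μ) hW id
  have h5 := ent_comp (μ := μ) hW (fun w => w.2.2)
  simp only [id] at h1 h2 h3 h5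
  set W : Ω → S × (T × U) := fun ω => (X ω, (Y ω, Z ω)) with hWdef
  set A := pr μ (fun ω => (X ω, Z ω)) with hA
  set B := pr μ (fun ω => (Y ω, Z ω)) with hB
  set C := pr μ Z with hC
  have a : ∀ w, pr μ W w ≤ A (w.1, w.2.2) := fun w =>
    pr_le_comp (μ := μ) (X := W) (fun w => (w.1, w.2.2)) w
  have b : ∀ w, pr μ W w ≤ B (w.2.1, w.2.2) := fun w =>
    pr_le_comp (μ := μ) (X := W) (fun w => (w.2.1, w.2.2)) w
  have c : ∀ w, pr μ W w ≤ C w.2.2 := fun w =>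
    pr_le_comp (μ := μ) (X := W) (fun w => w.2.2) w
  have n := pr_nonneg (μ := μ) W
  have key : ∀ w : S × (T × U), (A (w.1, w.2.2) * B (w.2.1, w.2.2) / C w.2.2 = 0 →
      pr μ W w = 0) := by
    intro w hw
    rcases div_eq_zero_iff.1 hw with h | h
    · rcases mul_eq_zero.1 h with h | h
      · exact le_antisymm ((a w).trans h.le) (n w)
      · exact le_antisymm ((b w).trans h.le) (n w)
    · exact le_antisymm ((c w).trans h.le) (n w)
  have h4 := sum_mul_log_sub_eq_zero_iff (a := pr μ W)
    (b := fun w => A (w.1, w.2.2) * B (w.2.1, w.2.2) / C w.2.2) n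
    (fun w => div_nonneg (mul_nonneg (pr_nonneg _ _) (pr_nonneg _ _)) (pr_nonneg _ _)) key
    (by
      rw [sum_pr hW, ← sum_pr (μ := μ) hZ, Fintype.sum_prod_type, Finset.sum_comm,
        Fintype.sum_prod_type_right]
      refine Finset.sum_congr rfl fun z _ => ?_
      simp_rw [← Finset.sum_div, ← Finset.sum_mul, ← Finset.mul_sum]
      rw [hA, hB, hC, sum_pr_fst hX hZ, sum_pr_fst hY hZ]
      by_cases hz : pr μ Z z = 0
      · simp [hz]
      · field_simp)
  simp only [Prod.forall] at h4
  have h6 : (∀ x y z, pr μ W (x, (y, z)) * C z = A (x, z) * B (y, z)) ↔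
      ∀ x y z, pr μ W (x, (y, z)) = A (x, z) * B (y, z) / C z := by
    refine forall_congr' fun x => forall_congr' fun y => forall_congr' fun z => ?_
    by_cases hz : C z = 0
    · have e1 := c (x, (y, z))
      have e2 := n (x, (y, z))
      have e3 : A (x, z) = 0 := le_antisymm
        ((pr_le_comp (μ := μ) (X := fun ω => (X ω, Z ω)) Prod.snd (x, z)).trans hz.le)
        (pr_nonneg _ _)
      simp only [hz] at e1
      simp [e3, hz, le_antisymm e1 e2]
    · rw [eq_div_iff hz]
  rw [h6, ← h4]
  unfold cmi
  rw [h1, h2, h3, h5, ← add_div, ← sub_div, ← sub_div, div_eq_zero_iff,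
    or_iff_left (log_pos one_lt_two).ne',
    ← Finset.sum_add_distrib, ← Finset.sum_sub_distrib, ← Finset.sum_sub_distrib]
  refine Eq.congr (Finset.sum_congr rfl fun w _ => ?_) rfl
  by_cases hw : pr μ W w = 0
  · simp [hw]
  · have := mt (key w) hw
    rw [div_eq_zero_iff, not_or, mul_eq_zero, not_or] at this
    rw [log_div (mul_ne_zero this.1.1 this.1.2) this.2, log_mul this.1.1 this.1.2]
    ring

lemma condEnt_eq_zero_iff {X : Ω → S} {Y : Ω → T} (hX : Measurable X) (hY : Measurable Y) :
    condEnt μ X Y = 0 ↔ ∀ x y, pr μ (fun ω => (X ω, Y ω)) (x, y) = 0 ∨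
      pr μ (fun ω => (X ω, Y ω)) (x, y) = pr μ Y y := by
  have hW := hX.prodMk hY
  have h2 := ent_comp (μ := μ) hW Prod.snd
  have h3 := ent_comp (μ := μ) hW id
  simp only [id] at h2 h3
  have b := fun w => pr_le_comp (μ := μ) (X := fun ω => (X ω, Y ω)) Prod.snd w
  have c := pr_nonneg (μ := μ) (fun ω => (X ω, Y ω))
  unfold condEnt
  rw [h2, h3, ← sub_div, div_eq_zero_iff, or_iff_left (log_pos one_lt_two).ne',
    ← Finset.sum_sub_distrib, Finset.sum_eq_zero_iff_of_nonneg]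
  · simp only [Finset.mem_univ, true_implies, Prod.forall]
    refine forall_congr' fun x => forall_congr' fun y => ?_
    rw [← mul_sub, mul_eq_zero]
    refine or_congr_right' fun hne => ?_
    have hpos := lt_of_le_of_ne (c (x, y)) (Ne.symm hne)
    have hpos' := hpos.trans_le (b (x, y))
    constructor
    · intro h
      exact log_injOn_pos hpos hpos' (by linarith)
    · intro h
      rw [h]; simp
  · intro w _
    rw [← mul_sub]
    rcases (c w).eq_or_lt with h | h
    · rw [← h]; simp
    · have := log_le_log h (b w)
      simp only at this
      exact mul_nonneg h.le (by linarith)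

/-- `H(X|Y) = 0` means that `X` is almost surely a function of `Y`. -/
lemma exists_ae_eq_of_condEnt_eq_zero {X : Ω → S} {Y : Ω → T} (hX : Measurable X)
    (hY : Measurable Y) (h : condEnt μ X Y = 0) : ∃ φ : T → S, ∀ᵐ ω ∂μ, X ω = φ (Y ω) := by
  classical
  rw [condEnt_eq_zero_iff hX hY] at h
  obtain ⟨ω₀⟩ : Nonempty Ω := nonempty_of_isProbabilityMeasure μ
  have key : ∀ y, ∃ x, ∀ x', x' ≠ x → pr μ (fun ω => (X ω, Y ω)) (x', y) = 0 := by
    intro y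
    by_cases hy : ∃ x, pr μ (fun ω => (X ω, Y ω)) (x, y) ≠ 0
    · obtain ⟨x, hx⟩ := hy
      refine ⟨x, fun x' hne => ?_⟩
      have h1 := (h x y).resolve_left hx
      have h2 := sum_pr_fst (μ := μ) hX hY y
      rw [← Finset.add_sum_erase _ _ (Finset.mem_univ x), h1] at h2
      have h3 : ∑ x' ∈ Finset.univ.erase x, pr μ (fun ω => (X ω, Y ω)) (x', y) = 0 := by linarith
      exact (Finset.sum_eq_zero_iff_of_nonneg fun _ _ => pr_nonneg _ _).1 h3 x' (by simp [hne])
    · push Not at hy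
      exact ⟨X ω₀, fun x' _ => hy x'⟩
  choose φ hφ using key
  refine ⟨φ, ?_⟩
  have : ∀ w : S × T, ∀ᵐ ω ∂μ, (X ω, Y ω) = w → w.1 = φ w.2 := by
    intro w
    by_cases hw : w.1 = φ w.2
    · simp [hw]
    · have h0 := hφ w.2 w.1 hw
      rw [pr, ENNReal.toReal_eq_zero_iff, or_iff_left (measure_ne_top _ _)] at h0
      have := measure_eq_zero_iff_ae_notMem.1 h0
      filter_upwards [this] with ω hω h'
      exact absurd h' hω
  filter_upwards [ae_all_iff.2 this] with ω hω
  exact hω _ rfl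

lemma condEnt_eq_zero_of_comp {X : Ω → S} {Y : Ω → T} (hX : Measurable X) (hY : Measurable Y)
    (φ : T → S) (h : ∀ ω, X ω = φ (Y ω)) : condEnt μ X Y = 0 := by
  rw [condEnt_eq_zero_iff hX hY]
  intro x y
  by_cases hxy : x = φ y
  · right
    unfold pr
    congr 2
    ext ω
    simp only [Set.mem_preimage, Set.mem_singleton_iff, Prod.mk.injEq, and_iff_right_iff_imp]
    rintro rfl
    rw [h, hxy]
  · left
    have : (fun ω => (X ω, Y ω)) ⁻¹' {(x, y)} = ∅ := by
      ext ω
      simp only [Set.mem_preimage, Set.mem_singleton_iff, Prod.mk.injEq, Set.mem_empty_iff_false,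
        iff_false, not_and]
      rintro h1 rfl
      exact hxy (h1 ▸ h ω)
    simp [pr, this]

lemma UniformOn.pr_eq {X : Ω → S} (hX : Measurable X) {n : ℕ} (h : UniformOn μ X n) {x : S}
    (hx : x ∈ support μ X) : pr μ X x = (n : ℝ)⁻¹ := by
  classical
  have h1 := sum_pr (μ := μ) hX
  rw [← Finset.sum_filter_add_sum_filter_not _ (fun y => y ∈ support μ X)] at h1
  rw [Finset.sum_eq_zero (s := Finset.univ.filter fun y => ¬ y ∈ support μ X), add_zero,
    Finset.sum_congr rfl (fun y hy => h.1 y (Finset.mem_filter.1 hy).2 x hx), Finset.sum_const,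
    ← Set.toFinset_ofPred, ← Set.ncard_eq_toFinset_card', nsmul_eq_mul] at h1
  · have : {y | y ∈ support μ X}.ncard = n := h.2
    rw [this] at h1
    exact eq_inv_of_mul_eq_one_right h1
  · intro y hy
    by_contra hne
    exact (Finset.mem_filter.1 hy).2 (mem_support_of_ne hne)

omit [IsProbabilityMeasure μ] [Fintype S] [MeasurableSpace S] [MeasurableSingletonClass S] in
open Classical in
lemma uniformOn_of_pr_eq {X : Ω → S} {A : Finset S} {c : ℝ} (hc : 0 < c)
    (h : ∀ x, pr μ X x = if x ∈ A then c else 0) : UniformOn μ X A.card := by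
  have hs : support μ X = A := by
    ext x
    simp only [support, Set.mem_ofPred_eq, h, Finset.mem_coe]
    split_ifs with hx <;> simp [hx, hc]
  refine ⟨fun x hx y hy => ?_, by rw [hs, Set.ncard_coe_finset]⟩
  rw [hs] at hx hy
  rw [h, h, if_pos (by simpa using hx), if_pos (by simpa using hy)]

/-- The law of a variable that is almost surely a function of a uniform variable. -/
lemma UniformOn.pr_eq_of_ae {R : Type*} [DecidableEq R] {X : Ω → S} (hX : Measurable X) {n : ℕ}
    (h : UniformOn μ X n) {A : Finset S} (hA : ∀ x, x ∈ A ↔ x ∈ support μ X) {Y : Ω → R}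
    {f : S → R} (hY : ∀ᵐ ω ∂μ, Y ω = f (X ω)) (y : R) :
    pr μ Y y = (A.filter fun x => f x = y).card * (n : ℝ)⁻¹ := by
  rw [pr_congr_ae hY, pr_comp hX, ← Finset.sum_filter,
    ← Finset.sum_subset (s₁ := A.filter fun x => f x = y) (Finset.filter_subset_filter _
      (Finset.subset_univ A)), Finset.sum_congr rfl
      (fun x hx => h.pr_eq hX ((hA x).1 (Finset.mem_filter.1 hx).1)), Finset.sum_const,
    nsmul_eq_mul]
  intro x hx hx'
  by_contra hne
  exact hx' (Finset.mem_filter.2 ⟨(hA x).2 (mem_support_of_ne hne), (Finset.mem_filter.1 hx).2⟩)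

lemma UniformOn.exists_of_mem_support {R : Type*} {X : Ω → S} (hX : Measurable X) {n : ℕ}
    (h : UniformOn μ X n) {A : Finset S} (hA : ∀ x, x ∈ A ↔ x ∈ support μ X) {Y : Ω → R}
    {f : S → R} (hY : ∀ᵐ ω ∂μ, Y ω = f (X ω)) {y : R} (hy : y ∈ support μ Y) :
    ∃ x ∈ A, f x = y := by
  classical
  by_contra! hne
  have h' : 0 < pr μ Y y := hy
  rw [h.pr_eq_of_ae hX hA hY, Finset.filter_false_of_mem hne] at h'
  simp at h'

open Classical in
/-- If `U` is uniform and is determined by a function `G` of it and a variable `Z` uniform over `m`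
values and independent of `G`, then the fibres of `G` have sizes dividing `m`. -/
lemma card_fiber_dvd {n m : ℕ} (hn : n ≠ 0) (hm : m ≠ 0) {X : Ω → S} {G : Ω → T} {Z : Ω → U}
    (hX : Measurable X) (hG : Measurable G) (hZ : Measurable Z) (hXu : UniformOn μ X n)
    {A : Finset S} (hA : ∀ x, x ∈ A ↔ x ∈ support μ X) {φ : S → T}
    (hφ : ∀ᵐ ω ∂μ, G ω = φ (X ω)) (hZu : UniformOn μ Z m) (hI : mi μ Z G = 0)
    (hH : condEnt μ X (fun ω => (G ω, Z ω)) = 0) {u : S} (hu : u ∈ A) :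
    (A.filter fun v => φ v = φ u).card ∣ m := by
  obtain ⟨ψ, hψ⟩ := exists_ae_eq_of_condEnt_eq_zero hX (hG.prodMk hZ) hH
  rw [mi_eq_zero_iff hZ hG] at hI
  have e₁ : pr μ X u = pr μ (fun ω => (ψ (φ u, Z ω), G ω)) (u, φ u) := by
    unfold pr
    congr 1
    apply measure_congr
    filter_upwards [hφ, hψ] with ω h₁ h₂
    apply propext
    change X ω = u ↔ (ψ (φ u, Z ω), G ω) = (u, φ u)
    rw [Prod.mk.injEq]
    constructor
    · rintro rfl
      exact ⟨by rw [← h₁, ← h₂], h₁⟩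
    · rintro ⟨h₃, h₄⟩
      rw [h₂, h₄, h₃]
  have e₂ := pr_comp (μ := μ) (hZ.prodMk hG) (fun w : U × T => (ψ (φ u, w.1), w.2)) (u, φ u)
  have e₃ := hXu.pr_eq_of_ae hX hA hφ (φ u)
  obtain ⟨B, hB⟩ : ∃ B : Finset U, ∀ z, z ∈ B ↔ z ∈ support μ Z :=
    ⟨Finset.univ.filter fun z => z ∈ support μ Z, by simp⟩
  have e₄ := hZu.pr_eq_of_ae hZ hB (f := fun z => ψ (φ u, z)) (Filter.Eventually.of_forall
    fun _ => rfl) u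
  rw [pr_comp hZ fun z => ψ (φ u, z)] at e₄
  have e₅ : pr μ X u = (∑ z, if ψ (φ u, z) = u then pr μ Z z else 0) * pr μ G (φ u) := by
    rw [e₁, e₂, Fintype.sum_prod_type, Finset.sum_mul]
    refine Finset.sum_congr rfl fun z _ => ?_
    simp only [Prod.mk.injEq, hI]
    by_cases hz : ψ (φ u, z) = u <;> simp [hz]
  rw [e₄, e₃, hXu.pr_eq hX ((hA u).1 hu)] at e₅
  refine ⟨(B.filter fun z => ψ (φ u, z) = u).card, Nat.cast_injective (R := ℝ) ?_⟩
  push_cast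
  field_simp at e₅
  linarith

lemma flipDist_of_entropy {V V₁ V₂ : Type*} [Fintype V] [Fintype V₁] [Fintype V₂]
    [MeasurableSpace V] [MeasurableSingletonClass V]
    [MeasurableSpace V₁] [MeasurableSingletonClass V₁]
    [MeasurableSpace V₂] [MeasurableSingletonClass V₂]
    {F : Ω → S} {G₁ : Ω → T} {G₂ : Ω → U} {X : Ω → V} {Z₁ : Ω → V₁} {Z₂ : Ω → V₂}
    (hF : Measurable F) (hG₁ : Measurable G₁) (hG₂ : Measurable G₂) (hX : Measurable X)
    (hZ₁ : Measurable Z₁) (hZ₂ : Measurable Z₂) (hXu : UniformOn μ X 4) (hFu : UniformOn μ F 2)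
    (hH : condEnt μ (fun ω => (F ω, G₁ ω, G₂ ω)) X = 0) (hc : cmi μ G₁ G₂ F = 0)
    (hZ₁u : UniformOn μ Z₁ 3) (hI₁ : mi μ Z₁ G₁ = 0)
    (hH₁ : condEnt μ X (fun ω => (G₁ ω, Z₁ ω)) = 0)
    (hZ₂u : UniformOn μ Z₂ 3) (hI₂ : mi μ Z₂ G₂ = 0)
    (hH₂ : condEnt μ X (fun ω => (G₂ ω, Z₂ ω)) = 0) : FlipDist μ F G₁ G₂ := by
  classical
  obtain ⟨φ, hφ⟩ := exists_ae_eq_of_condEnt_eq_zero (hF.prodMk (hG₁.prodMk hG₂)) hX hH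
  obtain ⟨f, hf⟩ : ∃ f : V → S, f = fun v => (φ v).1 := ⟨_, rfl⟩
  obtain ⟨g₁, hg₁⟩ : ∃ g : V → T, g = fun v => (φ v).2.1 := ⟨_, rfl⟩
  obtain ⟨g₂, hg₂⟩ : ∃ g : V → U, g = fun v => (φ v).2.2 := ⟨_, rfl⟩
  have hF' : ∀ᵐ ω ∂μ, F ω = f (X ω) := by
    filter_upwards [hφ] with ω h; simp only [hf, ← h]
  have hG₁' : ∀ᵐ ω ∂μ, G₁ ω = g₁ (X ω) := by
    filter_upwards [hφ] with ω h; simp only [hg₁, ← h]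
  have hG₂' : ∀ᵐ ω ∂μ, G₂ ω = g₂ (X ω) := by
    filter_upwards [hφ] with ω h; simp only [hg₂, ← h]
  clear hφ hf hg₁ hg₂ hH
  obtain ⟨A, mA⟩ : ∃ A : Finset V, ∀ x, x ∈ A ↔ x ∈ support μ X :=
    ⟨Finset.univ.filter fun x => x ∈ support μ X, by simp⟩
  have hAc : A.card = 4 := by
    have := hXu.2
    rw [← this, ← Set.ncard_coe_finset]
    congr 1
    ext u; simp [mA]
  have cF : ∀ u ∈ A, (A.filter fun v => f v = f u).card = 2 := by
    intro u hu
    have h0 : 0 < (A.filter fun v => f v = f u).card :=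
      Finset.card_pos.2 ⟨u, by simp [hu]⟩
    have h1 : f u ∈ support μ F := by
      change 0 < pr μ F (f u)
      rw [hXu.pr_eq_of_ae hX mA hF']; positivity
    have h2 := hFu.pr_eq hF h1
    rw [hXu.pr_eq_of_ae hX mA hF'] at h2
    push_cast at h2
    have h3 : ((A.filter fun v => f v = f u).card : ℝ) = 2 := by linarith
    exact_mod_cast h3
  have c₁ : ∀ u ∈ A, (A.filter fun v => g₁ v = g₁ u).card ∣ 3 := by
    intro u hu
    exact card_fiber_dvd four_ne_zero three_ne_zero hX hG₁ hZ₁ hXu mA hG₁' hZ₁u hI₁ hH₁ hu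
  have c₂ : ∀ u ∈ A, (A.filter fun v => g₂ v = g₂ u).card ∣ 3 := by
    intro u hu
    exact card_fiber_dvd four_ne_zero three_ne_zero hX hG₂ hZ₂ hXu mA hG₂' hZ₂u hI₂ hH₂ hu
  rw [cmi_eq_zero_iff hG₁ hG₂ hF] at hc
  have c₁₂ : ∀ u ∈ A, ∀ v ∈ A, f u = f v → g₁ u = g₁ v ∨ g₂ u = g₂ v := by
    intro u hu v hv huv
    by_contra! hne
    have huv' : u ≠ v := fun e => hne.1 (by rw [e])
    have hp := filter_pair_eq (cF u hu) hu hv huv' huv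
    have h0 := hc (g₁ u) (g₂ v) (f u)
    rw [hXu.pr_eq_of_ae hX mA (f := fun w => (g₁ w, (g₂ w, f w)))
        (by filter_upwards [hF', hG₁', hG₂'] with ω h₁ h₂ h₃; rw [h₁, h₂, h₃]),
      hXu.pr_eq_of_ae hX mA (f := fun w => (g₁ w, f w))
        (by filter_upwards [hF', hG₁'] with ω h₁ h₂; rw [h₁, h₂]),
      hXu.pr_eq_of_ae hX mA (f := fun w => (g₂ w, f w))
        (by filter_upwards [hF', hG₂'] with ω h₁ h₂; rw [h₁, h₂])] at h0
    rw [Finset.filter_false_of_mem, Finset.card_empty, Nat.cast_zero, zero_mul, zero_mul] at h0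
    · refine h0.not_lt (mul_pos (mul_pos (Nat.cast_pos.2 (Finset.card_pos.2 ⟨u, ?_⟩)) ?_)
        (mul_pos (Nat.cast_pos.2 (Finset.card_pos.2 ⟨v, ?_⟩)) ?_)) <;> simp [hu, hv, huv]
    · intro w hw e
      simp only [Prod.mk.injEq] at e
      have : w ∈ A.filter (fun w => f w = f u) := by simp [hw, e.2.2]
      rw [hp] at this
      simp only [Finset.mem_insert, Finset.mem_singleton] at this
      rcases this with rfl | rfl
      · exact hne.2 e.2.1
      · exact hne.1 e.1.symm
  obtain ⟨a, b, c, d, hAe, na, nb, nc, fb, fd, fc, g1b, g1c, g1d, g2b, g2c, g2d⟩ :=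
    exists_flip_pattern hAc f g₁ g₂ cF c₁ c₂ c₁₂
  have hmem : ∀ u ∈ A, u = a ∨ u = b ∨ u = c ∨ u = d := by
    intro u hu; rw [hAe] at hu; simpa using hu
  refine ⟨fun s => if s = f a then 0 else 1, fun t => if t = g₁ a then 0 else 1,
    fun t => if t = g₂ a then 0 else 1, ?_, ?_, ?_, ?_⟩
  · intro s hs s' hs' e
    obtain ⟨u, hu, rfl⟩ := hXu.exists_of_mem_support hX mA hF' hs
    obtain ⟨v, hv, rfl⟩ := hXu.exists_of_mem_support hX mA hF' hs'
    have := hmem u hu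
    have := hmem v hv
    grind
  · intro s hs s' hs' e
    obtain ⟨u, hu, rfl⟩ := hXu.exists_of_mem_support hX mA hG₁' hs
    obtain ⟨v, hv, rfl⟩ := hXu.exists_of_mem_support hX mA hG₁' hs'
    have := hmem u hu
    have := hmem v hv
    grind
  · intro s hs s' hs' e
    obtain ⟨u, hu, rfl⟩ := hXu.exists_of_mem_support hX mA hG₂' hs
    obtain ⟨v, hv, rfl⟩ := hXu.exists_of_mem_support hX mA hG₂' hs'
    have := hmem u hu
    have := hmem v hv
    grind
  · intro x y z
    rw [hXu.pr_eq_of_ae hX mA (f := fun w => ((if f w = f a then 0 else 1 : Fin 2),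
      (if g₁ w = g₁ a then 0 else 1 : Fin 2), (if g₂ w = g₂ a then 0 else 1 : Fin 2)))
      (by filter_upwards [hF', hG₁', hG₂'] with ω h₁ h₂ h₃; rw [h₁, h₂, h₃]), hAe,
      Finset.card_filter, Finset.sum_insert na, Finset.sum_insert nb, Finset.sum_insert nc,
      Finset.sum_singleton]
    simp only [fb, fd, fc, g1b, g1c, g1d, g2b, g2c, g2d, if_true, if_false]
    fin_cases x <;> fin_cases y <;> fin_cases z <;> simp

end Entropy

section Transfer

variable {Ω Ω' : Type*} [MeasurableSpace Ω] [MeasurableSpace Ω'] {μ : Measure Ω} {ν : Measure Ω'}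
  {S T U : Type*} [Fintype S] [Fintype T] [Fintype U]
  [MeasurableSpace S] [MeasurableSingletonClass S]
  [MeasurableSpace T] [MeasurableSingletonClass T]
  [MeasurableSpace U] [MeasurableSingletonClass U]

omit [Fintype S] in
lemma pr_eq_of_identDistrib {X : Ω → S} {Y : Ω' → S} (h : IdentDistrib X Y μ ν) (x : S) :
    pr μ X x = pr ν Y x := by
  unfold pr
  rw [h.measure_preimage_eq (measurableSet_singleton x)]

lemma identDistrib_of_pr_eq [IsProbabilityMeasure μ] [IsProbabilityMeasure ν] {X : Ω → S}
    {Y : Ω' → S} (hX : Measurable X) (hY : Measurable Y) (h : ∀ x, pr μ X x = pr ν Y x) :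
    IdentDistrib X Y μ ν := by
  refine ⟨hX.aemeasurable, hY.aemeasurable, Measure.ext_of_singleton fun x => ?_⟩
  rw [Measure.map_apply hX (measurableSet_singleton x),
    Measure.map_apply hY (measurableSet_singleton x)]
  exact (ENNReal.toReal_eq_toReal_iff' (measure_ne_top _ _) (measure_ne_top _ _)).1 (h x)

lemma FlipDist.of_identDistrib [IsProbabilityMeasure μ] [IsProbabilityMeasure ν] {F : Ω → S}
    {G₁ : Ω → T} {G₂ : Ω → U} {F' : Ω' → S} {G₁' : Ω' → T} {G₂' : Ω' → U}
    (h : IdentDistrib (fun ω => (F ω, G₁ ω, G₂ ω)) (fun ω => (F' ω, G₁' ω, G₂' ω)) μ ν)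
    (hflip : FlipDist ν F' G₁' G₂') : FlipDist μ F G₁ G₂ := by
  obtain ⟨f, g₁, g₂, hf, hg₁, hg₂, hp⟩ := hflip
  have e₁ : support μ F = support ν F' := Set.ext fun s => by
    have e : pr μ F s = pr ν F' s := pr_eq_of_identDistrib (h.comp measurable_fst) s
    change 0 < pr μ F s ↔ 0 < pr ν F' s
    rw [e]
  have e₂ : support μ G₁ = support ν G₁' := Set.ext fun s => by
    have e : pr μ G₁ s = pr ν G₁' s  :=
      pr_eq_of_identDistrib (h.comp (measurable_fst.comp measurable_snd)) s
    change 0 < pr μ G₁ s ↔ 0 < pr ν G₁' s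
    rw [e]
  have e₃ : support μ G₂ = support ν G₂' := Set.ext fun s => by
    have e : pr μ G₂ s = pr ν G₂' s  :=
      pr_eq_of_identDistrib (h.comp (measurable_snd.comp measurable_snd)) s
    change 0 < pr μ G₂ s ↔ 0 < pr ν G₂' s
    rw [e]
  refine ⟨f, g₁, g₂, e₁ ▸ hf, e₂ ▸ hg₁, e₃ ▸ hg₂, fun a b c => ?_⟩
  rw [← hp a b c]
  exact pr_eq_of_identDistrib (h.comp (u := fun w => (f w.1, g₁ w.2.1, g₂ w.2.2))
    (measurable_of_finite _)) (a, b, c)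

end Transfer

section Model

/-- The uniform distribution on `Fin 4 × Fin 3`. -/
noncomputable def flipMeasure : Measure (Fin 4 × Fin 3) := uniformOn Set.univ

instance : IsProbabilityMeasure flipMeasure :=
  isProbabilityMeasure_uniformOn Set.finite_univ Set.univ_nonempty

lemma pr_flipMeasure {S : Type*} [DecidableEq S] (X : Fin 4 × Fin 3 → S) (x : S) :
    pr flipMeasure X x = ∑ i : Fin 4, ∑ j : Fin 3, if X (i, j) = x then (12 : ℝ)⁻¹ else 0 := by
  have h := pr_comp (μ := flipMeasure) measurable_id X x
  simp only [id] at h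
  rw [h, Fintype.sum_prod_type]
  refine Finset.sum_congr rfl fun i _ => Finset.sum_congr rfl fun j _ => ?_
  congr 1
  change (uniformOn Set.univ (id ⁻¹' {(i, j)})).toReal = _
  rw [Set.preimage_id, uniformOn_univ]
  simp

variable {Ω : Type*} [MeasurableSpace Ω] {μ : Measure Ω} [IsProbabilityMeasure μ]
  {S T U : Type*} [Fintype S] [Fintype T] [Fintype U]
  [MeasurableSpace S] [MeasurableSingletonClass S]
  [MeasurableSpace T] [MeasurableSingletonClass T]
  [MeasurableSpace U] [MeasurableSingletonClass U]

open Classical in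
lemma FlipDist.exists_law {F : Ω → S} {G₁ : Ω → T} {G₂ : Ω → U} (hF : Measurable F)
    (hG₁ : Measurable G₁) (hG₂ : Measurable G₂) (h : FlipDist μ F G₁ G₂) :
    ∃ s₀ s₁ t₀ t₁ u₀ u₁, s₀ ≠ s₁ ∧ t₀ ≠ t₁ ∧ u₀ ≠ u₁ ∧
      ∀ s t u, pr μ (fun ω => (F ω, G₁ ω, G₂ ω)) (s, t, u) =
        if (s, t, u) ∈ ({(s₀, t₀, u₀), (s₀, t₁, u₀), (s₁, t₀, u₀), (s₁, t₀, u₁)} :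
          Finset (S × T × U)) then 4⁻¹ else 0 := by
  obtain ⟨f, g₁, g₂, hf, hg₁, hg₂, hp⟩ := h
  obtain ⟨p, hpd⟩ : ∃ p, p = pr μ (fun ω => (F ω, G₁ ω, G₂ ω)) := ⟨_, rfl⟩
  have hW := hF.prodMk (hG₁.prodMk hG₂)
  have hs : ∀ w : S × T × U, p w ≠ 0 →
      w.1 ∈ support μ F ∧ w.2.1 ∈ support μ G₁ ∧ w.2.2 ∈ support μ G₂ := by
    intro w hw
    have hw' : 0 < pr μ (fun ω => (F ω, G₁ ω, G₂ ω)) w := by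
      rw [← hpd]; exact lt_of_le_of_ne (hpd ▸ pr_nonneg _ _) hw.symm
    exact ⟨hw'.trans_le (pr_le_comp (X := fun ω => (F ω, G₁ ω, G₂ ω)) (fun w => w.1) w),
      hw'.trans_le (pr_le_comp (X := fun ω => (F ω, G₁ ω, G₂ ω)) (fun w => w.2.1) w),
      hw'.trans_le (pr_le_comp (X := fun ω => (F ω, G₁ ω, G₂ ω)) (fun w => w.2.2) w)⟩
  have hsum : ∀ a b c, (∑ w, if (f w.1, g₁ w.2.1, g₂ w.2.2) = (a, b, c) then p w else 0) = _ :=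
    fun a b c => hpd ▸ (pr_comp hW (fun w => (f w.1, g₁ w.2.1, g₂ w.2.2)) (a, b, c)).symm.trans
      (hp a b c)
  have hin : ∀ s t u, s ∈ support μ F → t ∈ support μ G₁ → u ∈ support μ G₂ →
      p (s, t, u) = if (f s, g₁ t, g₂ u) ∈ ({((0:Fin 2), (0:Fin 2), (0:Fin 2)), (0, 1, 0),
        (1, 0, 0), (1, 0, 1)} : Finset (Fin 2 × Fin 2 × Fin 2)) then (4:ℝ)⁻¹ else 0 := by
    intro s t u ms mt mu
    rw [← hsum, Finset.sum_eq_single (s, t, u)]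
    · simp
    · rintro ⟨s', t', u'⟩ _ hne
      split_ifs with h
      · by_contra h0
        obtain ⟨ms', mt', mu'⟩ := hs _ h0
        simp only [Prod.mk.injEq] at h
        exact hne (Prod.ext (hf ms' ms h.1)
          (Prod.ext (hg₁ mt' mt h.2.1) (hg₂ mu' mu h.2.2)))
      · rfl
    · simp
  have hex : ∀ a b c, (a, b, c) ∈ ({((0:Fin 2), (0:Fin 2), (0:Fin 2)), (0, 1, 0),
        (1, 0, 0), (1, 0, 1)} : Finset (Fin 2 × Fin 2 × Fin 2)) →
        ∃ s t u, f s = a ∧ g₁ t = b ∧ g₂ u = c ∧ s ∈ support μ F ∧ t ∈ support μ G₁ ∧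
          u ∈ support μ G₂ := by
    intro a b c habc
    have h1 := hsum a b c
    rw [if_pos habc] at h1
    obtain ⟨⟨s, t, u⟩, -, h2⟩ := Finset.exists_ne_zero_of_sum_ne_zero
      (h1.trans_ne (by norm_num : (4 : ℝ)⁻¹ ≠ 0))
    rw [ite_ne_right_iff] at h2
    have h3 := hs _ h2.2
    simp only [Prod.mk.injEq] at h2
    exact ⟨s, t, u, h2.1.1, h2.1.2.1, h2.1.2.2, h3⟩
  obtain ⟨s₀, t₁, u₀, fs₀, gt₁, gu₀, ms₀, mt₁, mu₀⟩ := hex 0 1 0 (by simp)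
  obtain ⟨s₁, t₀, u₁, fs₁, gt₀, gu₁, ms₁, mt₀, mu₁⟩ := hex 1 0 1 (by simp)
  refine ⟨s₀, s₁, t₀, t₁, u₀, u₁, ?_, ?_, ?_, ?_⟩
  · rintro rfl; simp [fs₀] at fs₁
  · rintro rfl; simp [gt₀] at gt₁
  · rintro rfl; simp [gu₀] at gu₁
  intro s t u
  rw [← hpd]
  by_cases hm : s ∈ support μ F ∧ t ∈ support μ G₁ ∧ u ∈ support μ G₂
  · obtain ⟨ms, mt, mu⟩ := hm
    rw [hin s t u ms mt mu]
    have i₁ : ∀ s', s' ∈ support μ F → (s = s' ↔ f s = f s') := fun s' h => (hf.eq_iff ms h).symm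
    have i₂ : ∀ s', s' ∈ support μ G₁ → (t = s' ↔ g₁ t = g₁ s') :=
      fun s' h => (hg₁.eq_iff mt h).symm
    have i₃ : ∀ s', s' ∈ support μ G₂ → (u = s' ↔ g₂ u = g₂ s') :=
      fun s' h => (hg₂.eq_iff mu h).symm
    simp only [Finset.mem_insert, Finset.mem_singleton, Prod.mk.injEq, i₁ _ ms₀, i₁ _ ms₁,
      i₂ _ mt₀, i₂ _ mt₁, i₃ _ mu₀, i₃ _ mu₁, fs₀, fs₁, gt₀, gt₁, gu₀, gu₁]
  · have h0 : p (s, t, u) = 0 := by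
      by_contra h
      exact hm (hs _ h)
    rw [h0, if_neg]
    simp only [Finset.mem_insert, Finset.mem_singleton, Prod.mk.injEq]
    rintro (⟨rfl, rfl, rfl⟩ | ⟨rfl, rfl, rfl⟩ | ⟨rfl, rfl, rfl⟩ | ⟨rfl, rfl, rfl⟩) <;>
      exact hm ⟨‹_›, ‹_›, ‹_›⟩

lemma eq_or_eq_or_ne {α : Type*} (a b x : α) :
    x = a ∨ x = b ∨ (a ≠ x ∧ b ≠ x ∧ x ≠ a ∧ x ≠ b) := by
  by_cases h : x = a
  · exact Or.inl h
  by_cases h' : x = b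
  · exact Or.inr (Or.inl h')
  exact Or.inr (Or.inr ⟨Ne.symm h, Ne.symm h', h, h'⟩)

lemma vec_four_two {α : Type*} (a b c d : α) : ![a, b, c, d] 2 = c := rfl

lemma vec_four_three {α : Type*} (a b c d : α) : ![a, b, c, d] 3 = d := rfl

end Model

/-- the FLIP characterization. -/
theorem stmt_3 {Ω : Type*} [MeasurableSpace Ω] (μ : Measure Ω) [IsProbabilityMeasure μ]
    {S T U : Type*} [Fintype S] [Fintype T] [Fintype U]
    [MeasurableSpace S] [MeasurableSingletonClass S]
    [MeasurableSpace T] [MeasurableSingletonClass T]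
    [MeasurableSpace U] [MeasurableSingletonClass U]
    (F : Ω → S) (G₁ : Ω → T) (G₂ : Ω → U)
    (hF : Measurable F) (hG₁ : Measurable G₁) (hG₂ : Measurable G₂) :
    (∃ (P : ProbSpace) (F' : P.carrier → S) (G₁' : P.carrier → T) (G₂' : P.carrier → U)
      (TU TZ₁ TZ₂ : FinAlphabet) (U' : P.carrier → TU.carrier)
      (Z₁ : P.carrier → TZ₁.carrier) (Z₂ : P.carrier → TZ₂.carrier),
      Measurable F' ∧ Measurable G₁' ∧ Measurable G₂' ∧
      Measurable U' ∧ Measurable Z₁ ∧ Measurable Z₂ ∧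
      IdentDistrib (fun ω => (F ω, G₁ ω, G₂ ω)) (fun ω => (F' ω, G₁' ω, G₂' ω)) μ P.μ ∧
      UniformOn P.μ U' 4 ∧ UniformOn P.μ F' 2 ∧
      condEnt P.μ (fun ω => (F' ω, G₁' ω, G₂' ω)) U' = 0 ∧
      cmi P.μ G₁' G₂' F' = 0 ∧
      UniformOn P.μ Z₁ 3 ∧ mi P.μ Z₁ G₁' = 0 ∧
      condEnt P.μ U' (fun ω => (G₁' ω, Z₁ ω)) = 0 ∧
      UniformOn P.μ Z₂ 3 ∧ mi P.μ Z₂ G₂' = 0 ∧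
      condEnt P.μ U' (fun ω => (G₂' ω, Z₂ ω)) = 0) ↔
    FlipDist μ F G₁ G₂ := by
  classical
  constructor
  · rintro ⟨P, F', G₁', G₂', TU, TZ₁, TZ₂, X, Z₁, Z₂, mF, mG₁, mG₂, mX, mZ₁, mZ₂, hD, hX, hFu, hH,
      hc, hZ₁, hI₁, hH₁, hZ₂, hI₂, hH₂⟩
    exact (flipDist_of_entropy mF mG₁ mG₂ mX mZ₁ mZ₂ hX hFu hH hc hZ₁ hI₁ hH₁ hZ₂ hI₂
      hH₂).of_identDistrib hD
  · intro h
    obtain ⟨s₀, s₁, t₀, t₁, u₀, u₁, hs, ht, hu, hlaw⟩ := h.exists_law hF hG₁ hG₂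
    have hs' := hs.symm
    have ht' := ht.symm
    have hu' := hu.symm
    refine ⟨⟨Fin 4 × Fin 3, flipMeasure⟩, fun ω => ![s₀, s₀, s₁, s₁] ω.1,
      fun ω => ![t₀, t₁, t₀, t₀] ω.1, fun ω => ![u₀, u₀, u₀, u₁] ω.1, ⟨Fin 4⟩, ⟨Fin 3⟩, ⟨Fin 3⟩,
      fun ω => ω.1, fun ω => if ω.1 = 1 then ω.2 else ![0, 0, 1, 2] ω.1,
      fun ω => if ω.1 = 3 then ω.2 else ![0, 1, 2, 0] ω.1,
      measurable_of_finite _, measurable_of_finite _, measurable_of_finite _,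
      measurable_of_finite _, measurable_of_finite _, measurable_of_finite _,
      ?_, ?_, ?_, ?_, ?_, ?_, ?_, ?_, ?_, ?_, ?_⟩
    · refine identDistrib_of_pr_eq (hF.prodMk (hG₁.prodMk hG₂)) (measurable_of_finite _) ?_
      rintro ⟨s, t, u⟩
      rw [hlaw, pr_flipMeasure]
      simp only [Fin.sum_univ_four, Fin.sum_univ_three]
      rcases eq_or_eq_or_ne s₀ s₁ s with rfl | rfl | ⟨_, _, _, _⟩ <;>
      rcases eq_or_eq_or_ne t₀ t₁ t with rfl | rfl | ⟨_, _, _, _⟩ <;>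
      rcases eq_or_eq_or_ne u₀ u₁ u with rfl | rfl | ⟨_, _, _, _⟩ <;>
      norm_num [vec_four_two, vec_four_three, *]
    · refine uniformOn_of_pr_eq (A := (Finset.univ : Finset (Fin 4))) (c := 4⁻¹) (by norm_num) ?_
      intro x
      rw [pr_flipMeasure]
      fin_cases x <;> norm_num [vec_four_two, vec_four_three, Fin.sum_univ_four]
    · rw [← Finset.card_pair hs]
      refine uniformOn_of_pr_eq (c := 2⁻¹) (by norm_num) ?_
      intro x
      rw [pr_flipMeasure]
      simp only [Fin.sum_univ_four, Fin.sum_univ_three]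
      rcases eq_or_eq_or_ne s₀ s₁ x with rfl | rfl | ⟨_, _, _, _⟩ <;>
      norm_num [vec_four_two, vec_four_three, *]
    · exact condEnt_eq_zero_of_comp (measurable_of_finite _) (measurable_of_finite _)
        (fun i : Fin 4 => (![s₀, s₀, s₁, s₁] i, ![t₀, t₁, t₀, t₀] i, ![u₀, u₀, u₀, u₁] i))
        (fun _ => rfl)
    · rw [cmi_eq_zero_iff (measurable_of_finite _) (measurable_of_finite _)
        (measurable_of_finite _)]
      intro t u s
      simp only [pr_flipMeasure, Fin.sum_univ_four, Fin.sum_univ_three]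
      rcases eq_or_eq_or_ne s₀ s₁ s with rfl | rfl | ⟨_, _, _, _⟩ <;>
      rcases eq_or_eq_or_ne t₀ t₁ t with rfl | rfl | ⟨_, _, _, _⟩ <;>
      rcases eq_or_eq_or_ne u₀ u₁ u with rfl | rfl | ⟨_, _, _, _⟩ <;>
      norm_num [vec_four_two, vec_four_three, *]
    · refine uniformOn_of_pr_eq (A := (Finset.univ : Finset (Fin 3))) (c := 3⁻¹) (by norm_num) ?_
      intro x
      rw [pr_flipMeasure]
      fin_cases x <;> simp +decide [Fin.sum_univ_four, Fin.sum_univ_three] <;> norm_num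
    · rw [mi_eq_zero_iff (measurable_of_finite _) (measurable_of_finite _)]
      intro z t
      simp only [pr_flipMeasure, Fin.sum_univ_four, Fin.sum_univ_three]
      rcases eq_or_eq_or_ne t₀ t₁ t with rfl | rfl | ⟨_, _, _, _⟩ <;>
      fin_cases z <;> simp +decide [vec_four_two, vec_four_three, *] <;> norm_num
    · refine condEnt_eq_zero_of_comp (measurable_of_finite _) (measurable_of_finite _)
        (fun w : T × Fin 3 => if w.1 = t₁ then (1 : Fin 4) else ![0, 2, 3] w.2) ?_
      rintro ⟨i, j⟩
      fin_cases i <;> simp [vec_four_two, vec_four_three, *]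
    · refine uniformOn_of_pr_eq (A := (Finset.univ : Finset (Fin 3))) (c := 3⁻¹) (by norm_num) ?_
      intro x
      rw [pr_flipMeasure]
      fin_cases x <;> simp +decide [Fin.sum_univ_four, Fin.sum_univ_three] <;> norm_num
    · rw [mi_eq_zero_iff (measurable_of_finite _) (measurable_of_finite _)]
      intro z t
      simp only [pr_flipMeasure, Fin.sum_univ_four, Fin.sum_univ_three]
      rcases eq_or_eq_or_ne u₀ u₁ t with rfl | rfl | ⟨_, _, _, _⟩ <;>
      fin_cases z <;> simp +decide [vec_four_two, vec_four_three, *] <;> norm_num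
    · refine condEnt_eq_zero_of_comp (measurable_of_finite _) (measurable_of_finite _)
        (fun w : U × Fin 3 => if w.1 = u₁ then (3 : Fin 4) else ![0, 1, 2] w.2) ?_
      rintro ⟨i, j⟩
      fin_cases i <;> simp [vec_four_two, vec_four_three, *]

end CIPaper
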